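/- Let A = ⊕_{i=1}^r ℤ/ℓ^{a_i} and B = ⊕_{i=1}^{r'} ℤ/ℓ^{b_i} with a_i ≥ a_j and b_i ≥ b_j whenever i ≤ j, and with all a_i, b_i ≥ 1. Then the number of subgroups of B isomorphic to A equals ∏_{i=1}^r ( ℓ^{Σ_{j=i}^{r'} min(a_i, b_j)} − ℓ^{Σ_{j=i}^{r'} min(a_i − 1, b_j)} ) / ( ℓ^{Σ_{j=i}^{r} a_j} − ℓ^{Σ_{j=i}^{r} min(a_i − 1, a_j)} ). -/

import Mathlib

/-- `sub(A,B)`: the number of subgroups of `B` isomorphic to `A`. -/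
noncomputable def subG (A B : Type) [AddCommGroup A] [AddCommGroup B] : ℕ :=
  Nat.card {H : AddSubgroup B // Nonempty (H ≃+ A)}

theorem Nat.card_eq_mul_of_card_fiber {α β : Type*} [Finite α] [Finite β] (g : α → β) (c : ℕ)
    (h : ∀ b, Nat.card {x // g x = b} = c) : Nat.card α = Nat.card β * c := by
  have := Fintype.ofFinite β
  rw [← Nat.card_congr (Equiv.sigmaFiberEquiv g), Nat.card_sigma,
    Finset.sum_congr rfl fun b _ => h b,
    Finset.sum_const, Finset.card_univ, Nat.card_eq_fintype_card, smul_eq_mul]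

/-- The subgroups of `B` isomorphic to `A` are the orbits of the automorphisms of `A`, acting freely
on the embeddings of `A` in `B`. -/
theorem card_injective_addMonoidHom_eq_subG_mul (A B : Type) [AddCommGroup A] [AddCommGroup B]
    [Finite A] [Finite B] :
    Nat.card {f : A →+ B // Function.Injective f} =
      subG A B * Nat.card {f : A →+ A // Function.Injective f} := by
  have hAB : Finite (A →+ B) := Finite.of_injective _ DFunLike.coe_injective
  have hS : Finite (AddSubgroup B) := Finite.of_injective _ SetLike.coe_injective
  let rangeMap : {f : A →+ B // Function.Injective f} →
      {H : AddSubgroup B // Nonempty (H ≃+ A)} :=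
    fun f => ⟨f.1.range, ⟨(AddMonoidHom.ofInjective f.2).symm⟩⟩
  refine Nat.card_eq_mul_of_card_fiber rangeMap _ ?_
  rintro ⟨H, ⟨e⟩⟩
  have e₁ : {f // rangeMap f = ⟨H, ⟨e⟩⟩} ≃ (A ≃+ H) :=
    { toFun := fun f => (AddMonoidHom.ofInjective f.1.2).trans
        (AddEquiv.addSubgroupCongr (congrArg Subtype.val f.2))
      invFun := fun u => ⟨⟨H.subtype.comp u.toAddMonoidHom,
          H.subtype_injective.comp u.injective⟩, by
        apply Subtype.ext
        ext x
        constructor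
        · rintro ⟨y, rfl⟩
          exact (u y).2
        · intro hx
          exact ⟨u.symm ⟨x, hx⟩, by simp⟩⟩
      left_inv := fun f => by
        apply Subtype.ext
        apply Subtype.ext
        ext x
        rfl
      right_inv := fun u => by
        ext x
        rfl }
  have e₂ : (A ≃+ H) ≃ {f : A →+ A // Function.Injective f} :=
    { toFun := fun u => ⟨(u.trans e).toAddMonoidHom, (u.trans e).injective⟩
      invFun := fun f =>
        (AddEquiv.ofBijective f.1 (Finite.injective_iff_bijective.1 f.2)).trans e.symm
      left_inv := fun u => by
        ext x
        simp
      right_inv := fun f => by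
        apply Subtype.ext
        ext x
        simp }
  exact Nat.card_congr (e₁.trans e₂)

/-- Homomorphisms out of a cyclic group of order `m` are given by `m`-torsion elements. -/
def ZMod.homOfTorsion {B : Type*} [AddCommGroup B] (m : ℕ) (x : B) (hx : m • x = 0) : ZMod m →+ B :=
  ZMod.lift m ⟨zmultiplesHom B x, by simpa using hx⟩

theorem ZMod.homOfTorsion_intCast {B : Type*} [AddCommGroup B] (m : ℕ) (x : B) (hx : m • x = 0)
    (k : ℤ) : ZMod.homOfTorsion m x hx (k : ZMod m) = k • x := by
  simp [ZMod.homOfTorsion]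

theorem ZMod.homOfTorsion_one {B : Type*} [AddCommGroup B] (m : ℕ) (x : B) (hx : m • x = 0) :
    ZMod.homOfTorsion m x hx 1 = x := by
  simpa using ZMod.homOfTorsion_intCast m x hx 1

theorem AddMonoidHom.injective_coprod_homOfTorsion {G B : Type*} [AddCommGroup G] [AddCommGroup B]
    {p n : ℕ} (hp : p.Prime) {f : G →+ B} (hf : Function.Injective f) {x : B}
    (hx : p ^ (n + 1) • x = 0) (hxf : p ^ n • x ∉ f.range) :
    Function.Injective (f.coprod (ZMod.homOfTorsion (p ^ (n + 1)) x hx)) := by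
  rw [injective_iff_map_eq_zero]
  rintro ⟨g, z⟩ h
  obtain ⟨k, rfl⟩ := ZMod.intCast_surjective z
  rw [AddMonoidHom.coprod_apply, ZMod.homOfTorsion_intCast] at h
  have hk : ((k : ℤ) : ZMod (p ^ (n + 1))) = 0 := by
    rw [ZMod.intCast_zmod_eq_zero_iff_dvd]
    by_contra hdvd
    obtain ⟨i, hi, hgcd⟩ := (Nat.dvd_prime_pow hp).1
      (Int.gcd_dvd_natAbs_right k ((p ^ (n + 1) : ℕ) : ℤ))
    have hin : i ≤ n := by
      by_contra hlt
      obtain rfl : i = n + 1 := by omega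
      apply hdvd
      rw [← hgcd]
      exact Int.gcd_dvd_left ..
    apply hxf
    have hmem : p ^ i • x ∈ f.range := by
      refine ⟨-((Int.gcdA k ((p ^ (n + 1) : ℕ) : ℤ)) • g), ?_⟩
      have hbez := Int.gcd_eq_gcd_ab k ((p ^ (n + 1) : ℕ) : ℤ)
      rw [hgcd] at hbez
      have hfg : f g = -(k • x) := eq_neg_of_add_eq_zero_left h
      rw [map_neg, map_zsmul, hfg, smul_neg, neg_neg, ← natCast_zsmul x (p ^ i), hbez, add_smul,
        mul_comm k, mul_smul, mul_comm ((p ^ (n + 1) : ℕ) : ℤ),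
        mul_smul _ ((p ^ (n + 1) : ℕ) : ℤ), natCast_zsmul, hx, smul_zero, add_zero]
    obtain ⟨d, rfl⟩ := Nat.exists_eq_add_of_le hin
    rw [pow_add, mul_comm, mul_smul]
    exact AddSubgroup.nsmul_mem _ hmem _
  have hk' : k • x = 0 := by
    rw [← ZMod.homOfTorsion_intCast _ x hx, hk, map_zero]
  rw [hk', add_zero] at h
  rw [hk, (injective_iff_map_eq_zero f).1 hf g h]
  rfl

theorem AddMonoidHom.notMem_range_of_injective_prod {G B : Type*} [AddCommGroup G] [AddCommGroup B]
    {p n : ℕ} (hp : p.Prime) {F : G × ZMod (p ^ (n + 1)) →+ B} (hF : Function.Injective F) :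
    p ^ n • F (0, 1) ∉ (F.comp (AddMonoidHom.inl G (ZMod (p ^ (n + 1))))).range := by
  rintro ⟨g, hg⟩
  rw [AddMonoidHom.comp_apply, AddMonoidHom.inl_apply, ← map_nsmul] at hg
  have h := congrArg Prod.snd (hF hg)
  simp only [Prod.smul_snd, nsmul_eq_mul, mul_one] at h
  have hdvd := (ZMod.natCast_eq_zero_iff _ _).1 h.symm
  have := (Nat.pow_dvd_pow_iff_le_right hp.one_lt).1 hdvd
  omega

/-- Extending a homomorphism from `G` to `G × ℤ/p^(n+1)`, injectively. -/
def injectiveExtensionEquiv {G B : Type*} [AddCommGroup G] [AddCommGroup B]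
    {p n : ℕ} (hp : p.Prime) {f : G →+ B} (hf : Function.Injective f) :
    {F : G × ZMod (p ^ (n + 1)) →+ B //
      Function.Injective F ∧ F.comp (AddMonoidHom.inl G (ZMod (p ^ (n + 1)))) = f} ≃
    {x : B // p ^ (n + 1) • x = 0 ∧ p ^ n • x ∉ f.range} where
  toFun F := ⟨F.1 (0, 1), by
    rw [← map_nsmul]
    have : p ^ (n + 1) • ((0, 1) : G × ZMod (p ^ (n + 1))) = 0 := by
      ext <;> simp
    rw [this, map_zero], by
    have := AddMonoidHom.notMem_range_of_injective_prod hp F.2.1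
    rwa [F.2.2] at this⟩
  invFun x := ⟨f.coprod (ZMod.homOfTorsion _ x.1 x.2.1),
    AddMonoidHom.injective_coprod_homOfTorsion hp hf x.2.1 x.2.2, by
      ext g
      simp⟩
  left_inv F := by
    apply Subtype.ext
    apply AddMonoidHom.ext
    rintro ⟨g, z⟩
    obtain ⟨k, rfl⟩ := ZMod.intCast_surjective z
    rw [AddMonoidHom.coprod_apply, ZMod.homOfTorsion_intCast, ← map_zsmul]
    have hg : f g = F.1 (g, 0) := (DFunLike.congr_fun F.2.2 g).symm
    rw [hg, ← map_add]
    congr 1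
    ext <;> simp
  right_inv x := by
    apply Subtype.ext
    simp [ZMod.homOfTorsion_one]

theorem card_torsion_preimage_range {G B : Type*} [AddCommGroup G] [AddCommGroup B]
    [Finite G] [Finite B] {p n : ℕ} (hG : ∀ g : G, p • g = 0 → ∃ h, p ^ n • h = g)
    {f : G →+ B} (hf : Function.Injective f) :
    Nat.card {x : B // p ^ (n + 1) • x = 0 ∧ p ^ n • x ∈ f.range} =
      Nat.card {g : G // p • g = 0} * Nat.card {x : B // p ^ n • x = 0} := by
  have hex (x : {x : B // p ^ (n + 1) • x = 0 ∧ p ^ n • x ∈ f.range}) :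
      ∃ g : {g : G // p • g = 0}, f g = p ^ n • x.1 := by
    obtain ⟨x, hx, g, hg⟩ := x
    refine ⟨⟨g, hf ?_⟩, hg⟩
    rw [map_nsmul, hg, map_zero, ← mul_smul, ← pow_succ', hx]
  choose φ hφ using hex
  refine Nat.card_eq_mul_of_card_fiber φ _ ?_
  rintro ⟨g, hg⟩
  obtain ⟨h, rfl⟩ := hG g hg
  refine Nat.card_congr
    { toFun := fun x => ⟨x.1.1 - f h, by
        have := hφ x.1
        rw [x.2] at this
        rw [smul_sub, ← this, map_nsmul, sub_self]⟩
      invFun := fun y => ⟨⟨y.1 + f h, ?_, ?_⟩, ?_⟩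
      left_inv := fun x => by
        apply Subtype.ext
        apply Subtype.ext
        simp
      right_inv := fun y => by
        apply Subtype.ext
        simp }
  · rw [pow_succ', mul_smul, smul_add, y.2, zero_add, ← map_nsmul, ← map_nsmul, hg, map_zero]
  · rw [smul_add, y.2, zero_add, ← map_nsmul]
    exact ⟨_, rfl⟩
  · apply Subtype.ext
    apply hf
    rw [hφ]
    simp [smul_add, y.2]

theorem card_injective_prod {G B : Type*} [AddCommGroup G] [AddCommGroup B]
    [Finite G] [Finite B] {p n : ℕ} (hp : p.Prime) (hG : ∀ g : G, p • g = 0 → ∃ h, p ^ n • h = g) :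
    (Nat.card {F : G × ZMod (p ^ (n + 1)) →+ B // Function.Injective F} : ℚ) =
      Nat.card {f : G →+ B // Function.Injective f} *
        (Nat.card {x : B // p ^ (n + 1) • x = 0} -
          Nat.card {g : G // p • g = 0} * Nat.card {x : B // p ^ n • x = 0}) := by
  have : NeZero (p ^ (n + 1)) := ⟨(pow_pos hp.pos _).ne'⟩
  have : Finite (G →+ B) := Finite.of_injective _ DFunLike.coe_injective
  have : Finite (G × ZMod (p ^ (n + 1)) →+ B) := Finite.of_injective _ DFunLike.coe_injective
  let res : {F : G × ZMod (p ^ (n + 1)) →+ B // Function.Injective F} →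
      {f : G →+ B // Function.Injective f} :=
    fun F => ⟨F.1.comp (AddMonoidHom.inl G _), F.2.comp (fun x y h => congrArg Prod.fst h)⟩
  have hsplit (f : G →+ B) (hf : Function.Injective f) :
      Nat.card {x : B // p ^ (n + 1) • x = 0 ∧ p ^ n • x ∉ f.range} =
        Nat.card {x : B // p ^ (n + 1) • x = 0} -
          Nat.card {g : G // p • g = 0} * Nat.card {x : B // p ^ n • x = 0} ∧
      Nat.card {g : G // p • g = 0} * Nat.card {x : B // p ^ n • x = 0} ≤
        Nat.card {x : B // p ^ (n + 1) • x = 0} := by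
    classical
    have e := Equiv.sumCompl
      (fun x : {x : B // p ^ (n + 1) • x = 0} => p ^ n • x.1 ∈ f.range)
    have h := Nat.card_congr e
    rw [Nat.card_sum, Nat.card_congr (Equiv.subtypeSubtypeEquivSubtypeInter
        (fun x : B => p ^ (n + 1) • x = 0) (fun x => p ^ n • x ∈ f.range)),
      Nat.card_congr (Equiv.subtypeSubtypeEquivSubtypeInter
        (fun x : B => p ^ (n + 1) • x = 0) (fun x => p ^ n • x ∉ f.range)),
      card_torsion_preimage_range hG hf] at h
    omega
  have hcard := Nat.card_eq_mul_of_card_fiber res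
    (Nat.card {x : B // p ^ (n + 1) • x = 0} -
      Nat.card {g : G // p • g = 0} * Nat.card {x : B // p ^ n • x = 0}) (by
    rintro ⟨f, hf⟩
    rw [← (hsplit f hf).1, ← Nat.card_congr (injectiveExtensionEquiv hp hf)]
    exact Nat.card_congr ((Equiv.subtypeEquivRight fun F => by simp [res]).trans
      (Equiv.subtypeSubtypeEquivSubtypeInter _
        (fun F : G × ZMod (p ^ (n + 1)) →+ B => F.comp (AddMonoidHom.inl G _) = f))))
  rw [hcard]
  rcases isEmpty_or_nonempty {f : G →+ B // Function.Injective f} with h | ⟨⟨f, hf⟩⟩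
  · simp
  · push_cast [Nat.cast_sub (hsplit f hf).2]
    rfl

theorem ZMod.card_nsmul_eq_zero (n d : ℕ) [NeZero n] :
    Nat.card {x : ZMod n // d • x = 0} = n.gcd d := by
  have h := IsAddCyclic.card_nsmulAddMonoidHom_ker (ZMod n) d
  rwa [Nat.card_zmod] at h

theorem ZMod.card_pow_nsmul_eq_zero {p : ℕ} (hp : p.Prime) (m k : ℕ) :
    Nat.card {x : ZMod (p ^ k) // p ^ m • x = 0} = p ^ min m k := by
  have : NeZero (p ^ k) := ⟨(pow_pos hp.pos _).ne'⟩
  rw [ZMod.card_nsmul_eq_zero]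
  rcases le_total m k with h | h
  · rw [min_eq_left h, Nat.gcd_eq_right (pow_dvd_pow p h)]
  · rw [min_eq_right h, Nat.gcd_eq_left (pow_dvd_pow p h)]

theorem card_pi_zmod_pow_nsmul_eq_zero {p : ℕ} (hp : p.Prime) (m s : ℕ) (b : ℕ → ℕ) :
    Nat.card {x : ∀ i : Fin s, ZMod (p ^ b i.val) // p ^ m • x = 0} =
      p ^ ∑ j ∈ Finset.range s, min m (b j) := by
  rw [Nat.card_congr ((Equiv.subtypeEquivRight fun x => by simp [funext_iff]).trans
    (Equiv.subtypePiEquivPi (p := fun (i : Fin s) (x : ZMod (p ^ b i.val)) => p ^ m • x = 0))),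
    Nat.card_pi]
  simp_rw [ZMod.card_pow_nsmul_eq_zero hp]
  rw [Finset.prod_pow_eq_pow_sum, Finset.sum_range]

theorem ZMod.exists_pow_nsmul_eq_of_nsmul_eq_zero {p : ℕ} (hp : p.Prime) {n k : ℕ} (h : n + 1 ≤ k)
    (z : ZMod (p ^ k)) (hz : p • z = 0) : ∃ w, p ^ n • w = z := by
  obtain ⟨d, rfl⟩ := Nat.exists_eq_add_of_le h
  obtain ⟨t, rfl⟩ := ZMod.intCast_surjective z
  have ht : ((p ^ (n + 1 + d) : ℕ) : ℤ) ∣ p * t := by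
    rw [← ZMod.intCast_zmod_eq_zero_iff_dvd]
    simpa using hz
  have hp0 : (p : ℤ) ≠ 0 := by exact_mod_cast hp.ne_zero
  obtain ⟨u, hu⟩ := ht
  have : t = p ^ n * (p ^ d * u) := by
    apply mul_left_cancel₀ hp0
    rw [hu]
    push_cast
    ring
  refine ⟨((p ^ d * u : ℤ) : ZMod _), ?_⟩
  rw [this]
  simp

/-- Splitting off the last coordinate of a finite product. -/
def piFinSuccAddEquiv {M : ℕ → Type*} [∀ i, AddCommGroup (M i)] (k : ℕ) :
    (∀ i : Fin (k + 1), M i.val) ≃+ (∀ i : Fin k, M i.val) × M k where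
  toFun f := (fun i => f i.castSucc, f (Fin.last k))
  invFun q := Fin.snoc (α := fun i : Fin (k + 1) => M i.val) q.1 q.2
  left_inv f := Fin.snoc_init_self f
  right_inv q := by
    ext1
    · funext i
      exact Fin.snoc_castSucc (α := fun i : Fin (k + 1) => M i.val) q.2 q.1 i
    · exact Fin.snoc_last (α := fun i : Fin (k + 1) => M i.val) q.2 q.1
  map_add' _ _ := rfl

theorem card_injective_congr {G G' B : Type*} [AddCommGroup G] [AddCommGroup G'] [AddCommGroup B]
    (e : G ≃+ G') : Nat.card {f : G →+ B // Function.Injective f} =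
      Nat.card {f : G' →+ B // Function.Injective f} :=
  Nat.card_congr
    { toFun := fun f => ⟨f.1.comp e.symm.toAddMonoidHom, f.2.comp e.symm.injective⟩
      invFun := fun f => ⟨f.1.comp e.toAddMonoidHom, f.2.comp e.injective⟩
      left_inv := fun f => by
        apply Subtype.ext
        ext x
        simp
      right_inv := fun f => by
        apply Subtype.ext
        ext x
        simp }

theorem card_injective_pi_zmod {p : ℕ} (hp : p.Prime) (k s : ℕ) (a b : ℕ → ℕ)
    (ha : ∀ i j, i ≤ j → j < k → a j ≤ a i) (ha1 : ∀ i, i < k → 1 ≤ a i) :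
    (Nat.card {f : (∀ i : Fin k, ZMod (p ^ a i.val)) →+ (∀ i : Fin s, ZMod (p ^ b i.val)) //
        Function.Injective f} : ℚ) =
      ∏ i ∈ Finset.range k, ((p : ℚ) ^ (∑ j ∈ Finset.range s, min (a i) (b j)) -
        (p : ℚ) ^ i * (p : ℚ) ^ (∑ j ∈ Finset.range s, min (a i - 1) (b j))) := by
  have hne (m : ℕ) : NeZero (p ^ m) := ⟨(pow_pos hp.pos _).ne'⟩
  induction k with
  | zero =>
    rw [Finset.prod_range_zero, Nat.cast_eq_one, Nat.card_eq_one_iff_unique]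
    refine ⟨⟨fun f g => ?_⟩, ⟨⟨0, fun x y _ => Subsingleton.elim _ _⟩⟩⟩
    apply Subtype.ext
    ext1 i
    exact i.elim0
  | succ k ih =>
    obtain ⟨n, hn⟩ : ∃ n, a k = n + 1 := ⟨a k - 1, by have := ha1 k (by omega); omega⟩
    rw [Finset.prod_range_succ, ← ih (fun i j h hj => ha i j h (by omega))
        (fun i h => ha1 i (by omega)),
      card_injective_congr (piFinSuccAddEquiv (M := fun i => ZMod (p ^ a i)) k)]
    have hG (g : ∀ i : Fin k, ZMod (p ^ a i.val)) (hg : p • g = 0) : ∃ h, p ^ n • h = g := by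
      choose w hw using fun i : Fin k => ZMod.exists_pow_nsmul_eq_of_nsmul_eq_zero hp
        (hn ▸ ha i.val k i.2.le (by omega)) (g i) (congrFun hg i)
      exact ⟨w, funext hw⟩
    rw [hn, card_injective_prod hp hG, card_pi_zmod_pow_nsmul_eq_zero hp,
      card_pi_zmod_pow_nsmul_eq_zero hp]
    have hsoc := card_pi_zmod_pow_nsmul_eq_zero hp 1 k a
    have hsum : ∑ j ∈ Finset.range k, min 1 (a j) = k := by
      rw [Finset.sum_congr rfl fun j hj => min_eq_left (ha1 j (by
        have := Finset.mem_range.1 hj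
        omega))]
      simp
    rw [pow_one, hsum] at hsoc
    rw [hsoc]
    push_cast
    rfl

theorem pow_sum_range_sub_eq {K : Type*} [CommRing K] (q : K) {i s c : ℕ} {b : ℕ → ℕ} (hc : 1 ≤ c)
    (his : i ≤ s) (hb : ∀ j, j < i → c ≤ b j) :
    q ^ (∑ j ∈ Finset.range s, min c (b j)) -
        q ^ i * q ^ (∑ j ∈ Finset.range s, min (c - 1) (b j)) =
      q ^ (i * c) * (q ^ (∑ j ∈ Finset.Ico i s, min c (b j)) -
        q ^ (∑ j ∈ Finset.Ico i s, min (c - 1) (b j))) := by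
  have h₁ : ∑ j ∈ Finset.range i, min c (b j) = i * c := by
    rw [Finset.sum_congr rfl fun j hj => min_eq_left (hb j (Finset.mem_range.1 hj))]
    simp
  have h₂ : ∑ j ∈ Finset.range i, min (c - 1) (b j) = i * (c - 1) := by
    rw [Finset.sum_congr rfl fun j hj =>
      min_eq_left ((Nat.sub_le c 1).trans (hb j (Finset.mem_range.1 hj)))]
    simp
  rw [← Finset.sum_range_add_sum_Ico (fun j => min c (b j)) his,
    ← Finset.sum_range_add_sum_Ico (fun j => min (c - 1) (b j)) his, h₁, h₂]
  obtain ⟨d, rfl⟩ := Nat.exists_eq_add_of_le hc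
  rw [Nat.add_sub_cancel_left]
  ring

/-- With `A = ⊕_{i=1}^r ℤ/ℓ^{a_i}` and `B = ⊕_{i=1}^{r'} ℤ/ℓ^{b_i}`
(exponents weakly decreasing and positive), the number of subgroups of `B` isomorphic to
`A` is the stated product of ratios. -/
theorem statement7 (ℓ : ℕ) (hp : ℓ.Prime) (hodd : Odd ℓ) (r r' : ℕ) (a b : ℕ → ℕ)
    (ha : ∀ i j, i ≤ j → j < r → a j ≤ a i) (hb : ∀ i j, i ≤ j → j < r' → b j ≤ b i)
    (ha1 : ∀ i, i < r → 1 ≤ a i) (hb1 : ∀ i, i < r' → 1 ≤ b i) :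
    (subG (∀ i : Fin r, ZMod (ℓ ^ a i.val)) (∀ i : Fin r', ZMod (ℓ ^ b i.val)) : ℚ)
      = ∏ i ∈ Finset.range r,
          (((ℓ : ℚ) ^ (∑ j ∈ Finset.Ico i r', min (a i) (b j))
              - (ℓ : ℚ) ^ (∑ j ∈ Finset.Ico i r', min (a i - 1) (b j)))
            / ((ℓ : ℚ) ^ (∑ j ∈ Finset.Ico i r, a j)
              - (ℓ : ℚ) ^ (∑ j ∈ Finset.Ico i r, min (a i - 1) (a j)))) := by
  have hne (m : ℕ) : NeZero (ℓ ^ m) := ⟨(pow_pos hp.pos _).ne'⟩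
  have hℓ : (ℓ : ℚ) ≠ 0 := by exact_mod_cast hp.ne_zero
  have hAB := card_injective_addMonoidHom_eq_subG_mul (∀ i : Fin r, ZMod (ℓ ^ a i.val))
    (∀ i : Fin r', ZMod (ℓ ^ b i.val))
  have hAut : (Nat.card
      {f : (∀ i : Fin r, ZMod (ℓ ^ a i.val)) →+ (∀ i : Fin r, ZMod (ℓ ^ a i.val)) //
        Function.Injective f} : ℚ) ≠ 0 := by
    have : Finite ((∀ i : Fin r, ZMod (ℓ ^ a i.val)) →+ (∀ i : Fin r, ZMod (ℓ ^ a i.val))) :=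
      Finite.of_injective _ DFunLike.coe_injective
    rw [Nat.cast_ne_zero, Nat.card_ne_zero]
    exact ⟨⟨⟨AddMonoidHom.id _, Function.injective_id⟩⟩, inferInstance⟩
  replace hAB := congrArg (Nat.cast (R := ℚ)) hAB
  rw [Nat.cast_mul] at hAB
  rw [eq_div_of_mul_eq hAut hAB.symm, card_injective_pi_zmod hp r r' a b ha ha1,
    card_injective_pi_zmod hp r r a a ha ha1, ← Finset.prod_div_distrib]
  by_cases h : ∃ i, i < r ∧ (r' ≤ i ∨ b i < a i)
  · classical
    obtain ⟨hir, hfail⟩ := Nat.find_spec h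
    have hmin (j : ℕ) (hj : j < Nat.find h) : j < r' ∧ a j ≤ b j := by
      have := Nat.find_min h hj
      push Not at this
      exact this (hj.trans hir)
    generalize Nat.find h = i at hir hfail hmin
    have hir' : i ≤ r' := by
      by_contra hlt
      exact (hmin r' (by omega)).1.ne rfl
    have hzero : (ℓ : ℚ) ^ (∑ j ∈ Finset.Ico i r', min (a i) (b j))
        - (ℓ : ℚ) ^ (∑ j ∈ Finset.Ico i r', min (a i - 1) (b j)) = 0 := by
      rw [sub_eq_zero]
      congr 1
      refine Finset.sum_congr rfl fun j hj => ?_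
      have hj := Finset.mem_Ico.1 hj
      have := hb i j hj.1 hj.2
      omega
    rw [Finset.prod_eq_zero (Finset.mem_range.2 hir), Finset.prod_eq_zero (Finset.mem_range.2 hir)]
    · rw [hzero, zero_div]
    · rw [pow_sum_range_sub_eq (ℓ : ℚ) (ha1 i hir) hir'
        fun j hj => (ha j i hj.le hir).trans (hmin j hj).2, hzero, mul_zero, zero_div]
  · push Not at h
    refine Finset.prod_congr rfl fun i hi => ?_
    have hir := Finset.mem_range.1 hi
    rw [pow_sum_range_sub_eq (ℓ : ℚ) (ha1 i hir) (h i hir).1.le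
        fun j hj => (ha j i hj.le hir).trans (h j (hj.trans hir)).2,
      pow_sum_range_sub_eq (ℓ : ℚ) (ha1 i hir) hir.le fun j hj => ha j i hj.le hir,
      mul_div_mul_left _ _ (pow_ne_zero _ hℓ)]
    congr 3
    refine Finset.sum_congr rfl fun j hj => ?_
    have hj := Finset.mem_Ico.1 hj
    exact min_eq_right (ha i j hj.1 hj.2)
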